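/- arXiv:2601.20320 — 3 statements merged into one kernel-verified Lean document; each statement's English description precedes it below -/
import Mathlib

section
/- Fix S > 0 and α ∈ (0,1), and let (r_n) be a sequence of reals with r_n > 1 such that (log n)/r_n → 0 and r_n/n → 0 as n → ∞. Then U_n(r_n,S;α) · (e·n/r_n) → 1 as n → ∞; that is, U_n(r_n,S;α) = (r_n/(e·n)) · (1 + o(1)), and since (S/α)^{1/r_n} → 1 this may equivalently be written U_n(r_n,S;α) = (r_n/(e·n)) · (S/α)^{1/r_n} · (1 + o(1)). -/
/-- The r-norm upper confidence bound of Lemma 1: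
`U_n(r, S; α) = (S/α)^(1/r) · ((r−1)/(n+r−1))^((r−1)/r) · (n/(n+r−1))^(n/r)`. -/
noncomputable def Ubound (n : ℕ) (r S α : ℝ) : ℝ :=
  (S / α) ^ (1 / r) * ((r - 1) / (n + r - 1)) ^ ((r - 1) / r) *
    ((n : ℝ) / (n + r - 1)) ^ ((n : ℝ) / r)

/-- The normalized bound as an exponential, in the small quantities `1 / r` and `(r - 1) / n`. -/
theorem Ubound_mul_eq_exp {S α : ℝ} (hS : 0 < S) (hα : 0 < α) {n : ℕ} (hn : 0 < n)
    {r : ℝ} (hr : 1 < r) :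
    Ubound n r S α * (Real.exp 1 * n / r) =
      Real.exp (Real.log (S / α) * r⁻¹ + (1 - r⁻¹) * Real.log (1 - r⁻¹)
        + r⁻¹ * Real.log r⁻¹ + Real.log n / r
        - (1 - r⁻¹) * Real.log (1 + (r - 1) / n)
        + (1 - (1 - r⁻¹) * (((r - 1) / n)⁻¹ * Real.log (1 + (r - 1) / n)))) := by
  have hn' : (0 : ℝ) < n := by exact_mod_cast hn
  have hr0 : 0 < r := by linarith
  have hr1 : 0 < r - 1 := by linarith
  have hsum : 0 < n + r - 1 := by linarith
  have hlog_sum : Real.log (1 + (r - 1) / n) = Real.log (n + r - 1) - Real.log n := by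
    rw [← Real.log_div hsum.ne' hn'.ne']
    congr 1
    field_simp
    ring
  have hlog_sub : Real.log (1 - r⁻¹) = Real.log (r - 1) - Real.log r := by
    rw [← Real.log_div hr1.ne' hr0.ne']
    congr 1
    field_simp
  have hprefactor : Real.exp 1 * n / r = Real.exp (1 + Real.log n - Real.log r) := by
    rw [Real.exp_sub, Real.exp_add, Real.exp_log hn', Real.exp_log hr0]
  rw [Ubound, Real.rpow_def_of_pos (div_pos hS hα), Real.rpow_def_of_pos (div_pos hr1 hsum),
    Real.rpow_def_of_pos (div_pos hn' hsum), hprefactor, ← Real.exp_add, ← Real.exp_add,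
    ← Real.exp_add, hlog_sum, hlog_sub, Real.log_inv, Real.log_div hr1.ne' hsum.ne',
    Real.log_div hn'.ne' hsum.ne']
  congr 1
  field_simp
  ring

theorem stmt13 (S α : ℝ) (hS : 0 < S) (hα : α ∈ Set.Ioo (0 : ℝ) 1)
    (r : ℕ → ℝ) (hr : ∀ n, 1 < r n)
    (hlog : Filter.Tendsto (fun n : ℕ => Real.log n / r n) Filter.atTop (nhds 0))
    (hsub : Filter.Tendsto (fun n : ℕ => r n / n) Filter.atTop (nhds 0)) :
    Filter.Tendsto (fun n : ℕ => Ubound n (r n) S α * (Real.exp 1 * n / r n))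
      Filter.atTop (nhds 1) := by
  have hinv : Filter.Tendsto (fun n => (r n)⁻¹) Filter.atTop (nhds 0) := by
    have hlog_inv : Filter.Tendsto (fun n : ℕ => (Real.log n)⁻¹) Filter.atTop (nhds 0) :=
      (Real.tendsto_log_atTop.comp tendsto_natCast_atTop_atTop).inv_tendsto_atTop
    have hmul := hlog.mul hlog_inv
    rw [mul_zero] at hmul
    refine hmul.congr' ?_
    filter_upwards [Filter.eventually_ge_atTop 2] with n hn
    have : Real.log n ≠ 0 := (Real.log_pos (by exact_mod_cast hn)).ne'
    field_simp
  have hw : Filter.Tendsto (fun n : ℕ => (r n - 1) / n) Filter.atTop (nhds 0) := by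
    simpa [sub_div] using hsub.sub tendsto_one_div_atTop_nhds_zero_nat
  have hw_ne : Filter.Tendsto (fun n : ℕ => (r n - 1) / n) Filter.atTop (nhdsWithin 0 {0}ᶜ) := by
    refine tendsto_nhdsWithin_iff.2 ⟨hw, ?_⟩
    filter_upwards [Filter.eventually_gt_atTop 0] with n hn
    have : (0 : ℝ) < n := by exact_mod_cast hn
    exact (div_pos (sub_pos.2 (hr n)) this).ne'
  have hslope : Filter.Tendsto
      (fun n : ℕ => ((r n - 1) / n)⁻¹ * Real.log (1 + (r n - 1) / n)) Filter.atTop (nhds 1) := by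
    have h := (hasDerivAt_iff_tendsto_slope_zero.1
      (Real.hasDerivAt_log (one_ne_zero (α := ℝ)))).comp hw_ne
    simpa [Function.comp_def] using h
  have hlog_w : Filter.Tendsto (fun n : ℕ => Real.log (1 + (r n - 1) / n))
      Filter.atTop (nhds 0) := by
    simpa using (hw.const_add 1).log (by norm_num)
  have hone_sub : Filter.Tendsto (fun n => 1 - (r n)⁻¹) Filter.atTop (nhds 1) := by
    simpa using hinv.const_sub 1
  have hmul_log : Filter.Tendsto (fun n => (r n)⁻¹ * Real.log (r n)⁻¹)
      Filter.atTop (nhds 0) := by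
    simpa only [zero_mul, Function.comp_def] using (Real.continuous_mul_log.tendsto 0).comp hinv
  have hexponent := (((((hinv.const_mul (Real.log (S / α))).add
    (hone_sub.mul (hone_sub.log one_ne_zero))).add hmul_log).add hlog).sub
    (hone_sub.mul hlog_w)).add ((hone_sub.mul hslope).const_sub 1)
  have hexp := (Real.continuous_exp.tendsto _).comp hexponent
  have hval : Real.exp (Real.log (S / α) * 0 + 1 * Real.log 1 + 0 + 0 - 1 * 0 + (1 - 1 * 1)) = 1 := by
    simp
  rw [hval] at hexp
  refine hexp.congr' ?_
  filter_upwards [Filter.eventually_gt_atTop 0] with n hn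
  exact (Ubound_mul_eq_exp hS hα.1 hn (hr n)).symm
end

section
/- Fix S > 0 and α ∈ (0,1), and for each integer n ≥ 3 let r*_n = log(S/α) + log n − log log n. Then n · U_n(r*_n, S; α) / (log n − log log n) → 1 as n → ∞; that is, U_n(r*_n, S; α) = ((log n − log log n)/n) · (1 + o(1)). -/
open Filter Topology in
/-- `log (1 + x) / x → 1` as `x → 0`, `x ≠ 0`. -/
theorem tendsto_log_one_add_div_self :
    Tendsto (fun x : ℝ => Real.log (1 + x) / x) (𝓝[≠] 0) (𝓝 1) := by
  have h : HasDerivAt (fun x : ℝ => Real.log (1 + x)) 1 0 := by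
    have h1 : HasDerivAt (fun x : ℝ => 1 + x) 1 0 := (hasDerivAt_id (0 : ℝ)).const_add 1
    simpa using h1.log (by norm_num)
  refine (hasDerivAt_iff_tendsto_slope.1 h).congr fun x => ?_
  simp [slope_def_field]

/-- Logarithm of the normalised bound `n * U / L`. -/
theorem log_mul_Ubound_div {n : ℕ} {r S α L : ℝ} (hn : 0 < n) (hr : 1 < r) (hL : 0 < L)
    (hSα : 0 < S / α) :
    Real.log (n * Ubound n r S α / L) =
      Real.log (S / α) / r + Real.log ((r - 1) / L) + Real.log n / r - Real.log (r - 1) / r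
        - (1 - 1 / r) * Real.log (1 + (r - 1) / n)
        - (r - 1) / r * (Real.log (1 + (r - 1) / n) / ((r - 1) / n)) := by
  have hn' : (0 : ℝ) < n := by exact_mod_cast hn
  have hr1 : 0 < r - 1 := by linarith
  have hr0 : r ≠ 0 := by linarith
  have hnr : (0 : ℝ) < n + r - 1 := by linarith
  have e : 1 + (r - 1) / n = (n + r - 1) / n := by field_simp; ring
  have a1 : 0 < (S / α) ^ (1 / r) := Real.rpow_pos_of_pos hSα _
  have a2 : 0 < ((r - 1) / (n + r - 1)) ^ ((r - 1) / r) := Real.rpow_pos_of_pos (by positivity) _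
  have a3 : 0 < ((n : ℝ) / (n + r - 1)) ^ ((n : ℝ) / r) := Real.rpow_pos_of_pos (by positivity) _
  rw [Ubound, e, Real.log_div (by positivity) hL.ne', Real.log_mul hn'.ne' (by positivity),
    Real.log_mul (by positivity) a3.ne', Real.log_mul a1.ne' a2.ne', Real.log_rpow hSα,
    Real.log_rpow (by positivity), Real.log_rpow (by positivity), Real.log_div hr1.ne' hnr.ne',
    Real.log_div hn'.ne' hnr.ne', Real.log_div hr1.ne' hL.ne', Real.log_div hnr.ne' hn'.ne']
  field_simp
  ring

open Filter Topology in
/-- If `r → ∞` and `log n / r → 1`, then the bound is asymptotic to `(r - c) / n` for any `c`. -/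
theorem tendsto_mul_Ubound_div {S α c : ℝ} (hSα : 0 < S / α) {r : ℕ → ℝ}
    (hr : Tendsto r atTop atTop)
    (hlog : Tendsto (fun n : ℕ => Real.log n / r n) atTop (𝓝 1)) :
    Tendsto (fun n : ℕ => n * Ubound n (r n) S α / (r n - c)) atTop (𝓝 1) := by
  have hinv : Tendsto (fun n => 1 / r n) atTop (𝓝 0) :=
    tendsto_const_nhds.div_atTop hr
  have hrc : ∀ a : ℝ, Tendsto (fun n => (r n - a) / r n) atTop (𝓝 1) := fun a => by
    have : Tendsto (fun n => 1 - a * (1 / r n)) atTop (𝓝 1) := by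
      simpa using (hinv.const_mul a).const_sub 1
    refine this.congr' ?_
    filter_upwards [hr.eventually_gt_atTop 0] with n hn
    field_simp
  have hratio : Tendsto (fun n => (r n - 1) / (r n - c)) atTop (𝓝 1) := by
    have := (hrc 1).div (hrc c) one_ne_zero
    rw [div_one] at this
    refine this.congr' ?_
    filter_upwards [hr.eventually_gt_atTop 0] with n hn
    exact div_div_div_cancel_right₀ hn.ne' _ _
  have hlogr : Tendsto (fun n => Real.log (r n - 1) / r n) atTop (𝓝 0) := by
    have h1 : Tendsto (fun n => Real.log (r n - 1) / (r n - 1)) atTop (𝓝 0) :=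
      Real.isLittleO_log_id_atTop.tendsto_div_nhds_zero.comp
        (tendsto_atTop_add_const_right _ (-1) hr)
    have := h1.mul (hrc 1)
    rw [zero_mul] at this
    refine this.congr' ?_
    filter_upwards [hr.eventually_gt_atTop 1] with n hn
    have : r n - 1 ≠ 0 := by linarith
    field_simp
  have hlogn : Tendsto (fun n : ℕ => Real.log n / n) atTop (𝓝 0) :=
    Real.isLittleO_log_id_atTop.tendsto_div_nhds_zero.comp tendsto_natCast_atTop_atTop
  have hx : Tendsto (fun n : ℕ => (r n - 1) / n) atTop (𝓝 0) := by
    have := ((hrc 1).div hlog one_ne_zero).mul hlogn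
    rw [mul_zero] at this
    refine this.congr' ?_
    filter_upwards [hr.eventually_gt_atTop 1, eventually_ge_atTop 2] with n hn hn2
    have h2 : (2 : ℝ) ≤ n := by exact_mod_cast hn2
    have : Real.log n ≠ 0 := (Real.log_pos (by linarith)).ne'
    simp only [Pi.div_apply]
    field_simp
  have hx' : Tendsto (fun n : ℕ => (r n - 1) / n) atTop (𝓝[≠] 0) := by
    refine tendsto_nhdsWithin_iff.2 ⟨hx, ?_⟩
    filter_upwards [hr.eventually_gt_atTop 1, eventually_gt_atTop 0] with n hn hn0
    have h2 : (0 : ℝ) < n := by exact_mod_cast hn0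
    exact (div_pos (by linarith) h2).ne'
  have hlog1 : Tendsto (fun n : ℕ => Real.log (1 + (r n - 1) / n)) atTop (𝓝 0) := by
    simpa using (hx.const_add 1).log (by norm_num)
  have key := (((((hinv.const_mul (Real.log (S / α))).add (hratio.log one_ne_zero)).add hlog).sub
    hlogr).sub ((hinv.const_sub 1).mul hlog1)).sub
    ((hrc 1).mul (tendsto_log_one_add_div_self.comp hx'))
  have key' := (Real.continuous_exp.tendsto _).comp key
  simp only [mul_zero, Real.log_one, add_zero, zero_add, sub_zero, mul_one, sub_self,
    Real.exp_zero] at key'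
  refine key'.congr' ?_
  filter_upwards [hr.eventually_gt_atTop 1, hr.eventually_gt_atTop c, eventually_gt_atTop 0]
    with n hn hnc hn0
  have hn' : (0 : ℝ) < n := by exact_mod_cast hn0
  have hL : 0 < r n - c := by linarith
  have hpos : 0 < n * Ubound n (r n) S α / (r n - c) := by
    have h1 : 0 < r n - 1 := by linarith
    have h2 : 0 < n + r n - 1 := by linarith
    unfold Ubound
    positivity
  rw [← Real.exp_log hpos, log_mul_Ubound_div hn0 hn hL hSα]
  simp only [Function.comp_apply, mul_one_div]

theorem stmt14 (S α : ℝ) (hS : 0 < S) (hα : α ∈ Set.Ioo (0 : ℝ) 1)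
    (rstar : ℕ → ℝ)
    (hrstar : ∀ n : ℕ, rstar n = Real.log (S / α) + Real.log n - Real.log (Real.log n)) :
    Filter.Tendsto
      (fun n : ℕ => (n : ℝ) * Ubound n (rstar n) S α / (Real.log n - Real.log (Real.log n)))
      Filter.atTop (nhds 1) := by
  have hl : Filter.Tendsto (fun n : ℕ => Real.log n) Filter.atTop Filter.atTop :=
    Real.tendsto_log_atTop.comp tendsto_natCast_atTop_atTop
  have hll : Filter.Tendsto (fun n : ℕ => Real.log (Real.log n) / Real.log n) Filter.atTop
      (nhds 0) := Real.isLittleO_log_id_atTop.tendsto_div_nhds_zero.comp hl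
  have hratio : Filter.Tendsto (fun n : ℕ => rstar n / Real.log n) Filter.atTop (nhds 1) := by
    have := ((hl.inv_tendsto_atTop.const_mul (Real.log (S / α))).add_const 1).sub hll
    simp only [mul_zero, zero_add, sub_zero] at this
    refine this.congr' ?_
    filter_upwards [hl.eventually_gt_atTop 0] with n hn
    rw [hrstar, Pi.inv_apply]
    field_simp
  have hr : Filter.Tendsto rstar Filter.atTop Filter.atTop := by
    refine (hratio.pos_mul_atTop one_pos hl).congr' ?_
    filter_upwards [hl.eventually_gt_atTop 0] with n hn
    exact div_mul_cancel₀ _ hn.ne'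
  have hlog : Filter.Tendsto (fun n : ℕ => Real.log n / rstar n) Filter.atTop (nhds 1) := by
    simpa using hratio.inv₀ one_ne_zero
  refine (tendsto_mul_Ubound_div (c := Real.log (S / α)) (div_pos hS hα.1) hr hlog).congr
    fun n => ?_
  congr 1
  rw [hrstar]
  ring
end

section
/- Fix S > 0 and α ∈ (0,1), and set γ = −log(1−α). For each integer n ≥ 3 define Φ_n(ε) = (1 − (1−ε)^n)^{⌊S/ε⌋} for ε ∈ (0,1), and let ε*_n = inf{ ε ∈ (0,1) : Φ_n(ε) ≥ 1 − α }. Then liminf_{n→∞} ( n·ε*_n − log n + log log n ) ≥ log(S/γ). In particular, n·ε*_n ≥ log(S/γ) + log n − log log n + o(1), so the critical prevalence has order at least n^{-1}(log n − log log n). -/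
/-- `Φ_n(ε) = (1 − (1−ε)^n)^⌊S/ε⌋`: the probability that, when `⌊S/ε⌋` categories each
have prevalence `ε`, every such category is observed at least once in `n` samples. -/
noncomputable def Phi (S : ℝ) (n : ℕ) (ε : ℝ) : ℝ :=
  (1 - (1 - ε) ^ n) ^ (Nat.floor (S / ε))

/-- The critical prevalence `ε*_n = inf {ε ∈ (0,1) : Φ_n(ε) ≥ 1 − α}`. -/
noncomputable def epsStar (S α : ℝ) (n : ℕ) : ℝ :=
  sInf {ε : ℝ | ε ∈ Set.Ioo (0 : ℝ) 1 ∧ 1 - α ≤ Phi S n ε}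

open Filter Topology

/-- The expansion `log n − log log n + b` of the solution `y` of `y * exp y = exp b * n`. -/
noncomputable def lambertApprox (b : ℝ) (n : ℕ) : ℝ :=
  Real.log n - Real.log (Real.log n) + b

theorem tendsto_log_natCast_atTop : Tendsto (fun n : ℕ => Real.log n) atTop atTop :=
  Real.tendsto_log_atTop.comp tendsto_natCast_atTop_atTop

theorem tendsto_lambertApprox_div_log (b : ℝ) :
    Tendsto (fun n : ℕ => lambertApprox b n / Real.log n) atTop (𝓝 1) := by
  have h1 : Tendsto (fun x : ℝ => Real.log x / x) atTop (𝓝 0) :=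
    Real.isLittleO_log_id_atTop.tendsto_div_nhds_zero
  have h2 : Tendsto (fun x : ℝ => b / x) atTop (𝓝 0) := tendsto_id.const_div_atTop b
  have h3 := ((tendsto_const_nhds (x := (1 : ℝ))).sub h1).add h2
  simp only [sub_zero, add_zero] at h3
  refine (h3.comp tendsto_log_natCast_atTop).congr' ?_
  filter_upwards [tendsto_log_natCast_atTop.eventually_gt_atTop 0] with n hn
  simp only [Function.comp, lambertApprox]
  field_simp

theorem tendsto_log_pow_div_natCast (k : ℕ) :
    Tendsto (fun n : ℕ => Real.log n ^ k / n) atTop (𝓝 0) :=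
  (Real.isLittleO_pow_log_id_atTop (n := k)).tendsto_div_nhds_zero.comp
    tendsto_natCast_atTop_atTop

theorem tendsto_lambertApprox_pow_div (b : ℝ) (k : ℕ) :
    Tendsto (fun n : ℕ => lambertApprox b n ^ k / n) atTop (𝓝 0) := by
  have h := ((tendsto_lambertApprox_div_log b).pow k).mul (tendsto_log_pow_div_natCast k)
  rw [mul_zero] at h
  refine h.congr' ?_
  filter_upwards [tendsto_log_natCast_atTop.eventually_gt_atTop 0] with n hn
  rw [div_pow, div_mul_div_cancel₀ (pow_pos hn k).ne']

theorem eventually_lambertApprox_ge (b : ℝ) :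
    ∀ᶠ n : ℕ in atTop, Real.log n / 2 ≤ lambertApprox b n := by
  filter_upwards [tendsto_log_natCast_atTop.eventually_gt_atTop 0,
    (tendsto_lambertApprox_div_log b).eventually_const_lt (show (1 / 2 : ℝ) < 1 by norm_num)]
    with n hn h
  rw [lt_div_iff₀ hn] at h
  linarith

theorem exp_neg_lambertApprox (b : ℝ) {n : ℕ} (hn : 0 < Real.log n) :
    Real.exp (-lambertApprox b n) = Real.log n / n * Real.exp (-b) := by
  have hn0 : (0 : ℝ) < n := by
    rcases n.eq_zero_or_pos with rfl | h
    · simp at hn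
    · exact_mod_cast h
  rw [lambertApprox, show -(Real.log n - Real.log (Real.log n) + b)
    = Real.log (Real.log n) - Real.log n + -b by ring, Real.exp_add, Real.exp_sub,
    Real.exp_log hn, Real.exp_log hn0]

theorem eventually_lambertApprox_div_mem (b : ℝ) :
    ∀ᶠ n : ℕ in atTop, lambertApprox b n / n ∈ Set.Ioo (0 : ℝ) (1 / 2) := by
  have h := tendsto_lambertApprox_pow_div b 1
  simp only [pow_one] at h
  filter_upwards [tendsto_log_natCast_atTop.eventually_gt_atTop 0,
    eventually_lambertApprox_ge b, eventually_gt_atTop 0,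
    h.eventually_lt_const (show (0 : ℝ) < 1 / 2 by norm_num)] with n hn hL hn0 h2
  have : (0 : ℝ) < n := by exact_mod_cast hn0
  exact ⟨div_pos (by linarith) this, h2⟩

theorem exp_neg_le_one_sub {x : ℝ} (hx : x ≤ 1 / 2) :
    Real.exp (-(x + 2 * x ^ 2)) ≤ 1 - x := by
  have hp : 0 < 1 - x := by linarith
  rw [← Real.le_log_iff_exp_le hp]
  refine le_trans ?_ (Real.one_sub_inv_le_log_of_pos hp)
  have : (1 - x)⁻¹ ≤ 1 + x + 2 * x ^ 2 := by
    rw [inv_le_iff_one_le_mul₀ hp]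
    nlinarith [mul_nonneg (sq_nonneg x) (show 0 ≤ 1 - 2 * x by linarith)]
  linarith

theorem one_sub_pow_mem_Icc {ε : ℝ} (h : ε ∈ Set.Ioo (0 : ℝ) 1) (n : ℕ) :
    (1 - ε) ^ n ∈ Set.Icc (0 : ℝ) 1 :=
  ⟨pow_nonneg (by linarith [h.2]) n, pow_le_one₀ (by linarith [h.2]) (by linarith [h.1])⟩

theorem Phi_mono {S : ℝ} (hS : 0 < S) (n : ℕ) {ε δ : ℝ} (hε : ε ∈ Set.Ioo (0 : ℝ) 1)
    (hδ : δ ∈ Set.Ioo (0 : ℝ) 1) (h : ε ≤ δ) : Phi S n ε ≤ Phi S n δ := by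
  have h1 := one_sub_pow_mem_Icc hε n
  have h2 : (1 - δ) ^ n ≤ (1 - ε) ^ n :=
    pow_le_pow_left₀ (by linarith [hδ.2]) (by linarith) n
  have hfl : Nat.floor (S / δ) ≤ Nat.floor (S / ε) :=
    Nat.floor_mono (div_le_div_of_nonneg_left hS.le hε.1 h)
  unfold Phi
  exact (pow_le_pow_of_le_one (by linarith [h1.2]) (by linarith [h1.1]) hfl).trans
    (pow_le_pow_left₀ (by linarith [h1.2]) (by linarith) _)

theorem Phi_le_exp (S : ℝ) (n : ℕ) {ε : ℝ} (hε : ε ∈ Set.Ioo (0 : ℝ) 1) :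
    Phi S n ε ≤ Real.exp (-((S / ε - 1) * (1 - ε) ^ n)) := by
  have h1 := one_sub_pow_mem_Icc hε n
  have h2 : 1 - (1 - ε) ^ n ≤ Real.exp (-(1 - ε) ^ n) := by
    linarith [Real.add_one_le_exp (-(1 - ε) ^ n)]
  refine (pow_le_pow_left₀ (by linarith [h1.2]) h2 _).trans ?_
  rw [← Real.exp_nat_mul]
  apply Real.exp_le_exp.2
  have := mul_le_mul_of_nonneg_right (Nat.lt_floor_add_one (S / ε)).le h1.1
  linarith

theorem one_sub_le_Phi {S : ℝ} (hS : 0 < S) (n : ℕ) {ε : ℝ} (hε : ε ∈ Set.Ioo (0 : ℝ) 1) :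
    1 - S / ε * (1 - ε) ^ n ≤ Phi S n ε := by
  have h1 := one_sub_pow_mem_Icc hε n
  have hb := one_add_mul_le_pow (a := -(1 - ε) ^ n) (by linarith [h1.2]) (Nat.floor (S / ε))
  have := mul_le_mul_of_nonneg_right (Nat.floor_le (div_pos hS hε.1).le) h1.1
  rw [Phi, sub_eq_add_neg (1 : ℝ) ((1 - ε) ^ n)]
  linarith

/-- For `b` large, prevalence `(log n − log log n + b) / n` is eventually sufficient. -/
theorem exists_eventually_le_Phi {S α : ℝ} (hS : 0 < S) (hα : 0 < α) :
    ∃ b : ℝ, ∀ᶠ n : ℕ in atTop, 1 - α ≤ Phi S n (lambertApprox b n / n) := by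
  refine ⟨Real.log (2 * S / α), ?_⟩
  set b := Real.log (2 * S / α) with hb
  filter_upwards [tendsto_log_natCast_atTop.eventually_gt_atTop 0,
    eventually_lambertApprox_ge b, eventually_gt_atTop 0,
    eventually_lambertApprox_div_mem b] with n hn hL hn0 hε
  have hn0' : (0 : ℝ) < n := by exact_mod_cast hn0
  have hL0 : 0 < lambertApprox b n := by linarith
  refine le_trans ?_ (one_sub_le_Phi hS n ⟨hε.1, by linarith [hε.2]⟩)
  have hpow : (1 - lambertApprox b n / n) ^ n ≤ Real.exp (-lambertApprox b n) := by
    have h := pow_le_pow_left₀ (by linarith [hε.2])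
      (Real.one_sub_le_exp_neg (lambertApprox b n / n)) n
    rwa [← Real.exp_nat_mul, mul_neg, mul_div_cancel₀ _ hn0'.ne'] at h
  have hexp : Real.exp (-b) = α / (2 * S) := by
    rw [Real.exp_neg, hb, Real.exp_log (by positivity), inv_div]
  rw [exp_neg_lambertApprox b hn, hexp] at hpow
  have h := mul_le_mul_of_nonneg_left hpow (div_pos hS hε.1).le
  have h2 : S / (lambertApprox b n / n) * (Real.log n / n * (α / (2 * S))) =
      α * (Real.log n / 2 / lambertApprox b n) := by
    field_simp
  have h3 : α * (Real.log n / 2 / lambertApprox b n) ≤ α :=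
    mul_le_of_le_one_right hα.le ((div_le_one hL0).2 hL)
  linarith

/-- For `b < log (S / γ)`, prevalence `(log n − log log n + b) / n` is eventually insufficient. -/
theorem eventually_Phi_lt {S γ b : ℝ} (hS : 0 < S) (hb : γ < S * Real.exp (-b)) :
    ∀ᶠ n : ℕ in atTop, Phi S n (lambertApprox b n / n) < Real.exp (-γ) := by
  have hfac : Tendsto (fun n : ℕ => S * (lambertApprox b n / Real.log n)⁻¹ - Real.log n ^ 1 / n)
      atTop (𝓝 (S * 1⁻¹ - 0)) :=
    (((tendsto_lambertApprox_div_log b).inv₀ one_ne_zero).const_mul S).sub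
      (tendsto_log_pow_div_natCast 1)
  have hexp : Tendsto (fun n : ℕ => Real.exp (-(2 * (lambertApprox b n ^ 2 / n))))
      atTop (𝓝 (Real.exp (-(2 * 0)))) :=
    (Real.continuous_exp.tendsto _).comp ((tendsto_lambertApprox_pow_div b 2).const_mul 2).neg
  have hlim := hfac.mul (hexp.const_mul (Real.exp (-b)))
  simp only [inv_one, mul_one, sub_zero, mul_zero, neg_zero, Real.exp_zero, pow_one]
    at hlim hfac
  filter_upwards [tendsto_log_natCast_atTop.eventually_gt_atTop 0,
    eventually_lambertApprox_ge b, eventually_gt_atTop 0, eventually_lambertApprox_div_mem b,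
    hlim.eventually_const_lt hb, hfac.eventually_const_lt hS] with n hn hL hn0 hε hlt hpos
  have hn0' : (0 : ℝ) < n := by exact_mod_cast hn0
  have hL0 : 0 < lambertApprox b n := by linarith
  refine (Phi_le_exp S n ⟨hε.1, by linarith [hε.2]⟩).trans_lt
    (Real.exp_lt_exp.2 (neg_lt_neg (hlt.trans_le ?_)))
  have hpow := pow_le_pow_left₀ (Real.exp_pos _).le (exp_neg_le_one_sub hε.2.le) n
  have hsplit : (n : ℝ) * -(lambertApprox b n / n + 2 * (lambertApprox b n / n) ^ 2) =
      -lambertApprox b n + -(2 * (lambertApprox b n ^ 2 / n)) := by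
    field_simp
    ring
  rw [← Real.exp_nat_mul, hsplit, Real.exp_add, exp_neg_lambertApprox b hn] at hpow
  have hrw : S * (lambertApprox b n / Real.log n)⁻¹ - Real.log n / n =
      (S / (lambertApprox b n / n) - 1) * (Real.log n / n) := by
    field_simp
  rw [hrw] at hpos ⊢
  have hm := mul_le_mul_of_nonneg_left hpow
    (pos_of_mul_pos_left hpos (div_pos hn hn0').le).le
  linarith

theorem stmt18 (S α : ℝ) (hS : 0 < S) (hα : α ∈ Set.Ioo (0 : ℝ) 1)
    (γ : ℝ) (hγ : γ = -Real.log (1 - α)) :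
    Real.log (S / γ) ≤
      Filter.liminf
        (fun n : ℕ =>
          (n : ℝ) * epsStar S α n - Real.log n + Real.log (Real.log n))
        Filter.atTop := by
  have hα1 : 0 < 1 - α := by linarith [hα.2]
  have hγ0 : 0 < γ := by
    rw [hγ]
    linarith [Real.log_neg hα1 (by linarith [hα.1])]
  have hexpγ : Real.exp (-γ) = 1 - α := by rw [hγ, neg_neg, Real.exp_log hα1]
  obtain ⟨c, hc⟩ := exists_eventually_le_Phi hS hα.1
  have hmem : ∀ᶠ n : ℕ in atTop, lambertApprox c n / n ∈
      {ε : ℝ | ε ∈ Set.Ioo (0 : ℝ) 1 ∧ 1 - α ≤ Phi S n ε} := by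
    filter_upwards [hc, eventually_lambertApprox_div_mem c] with n h1 h2
    exact ⟨⟨h2.1, by linarith [h2.2]⟩, h1⟩
  have hcob : IsCoboundedUnder (· ≥ ·) atTop
      (fun n : ℕ => (n : ℝ) * epsStar S α n - Real.log n + Real.log (Real.log n)) := by
    refine IsBoundedUnder.isCoboundedUnder_ge ⟨c, eventually_map.2 ?_⟩
    filter_upwards [hmem, eventually_gt_atTop 0] with n h1 hn0
    have hn0' : (0 : ℝ) < n := by exact_mod_cast hn0
    have h2 : epsStar S α n ≤ lambertApprox c n / n := csInf_le ⟨0, fun x hx => hx.1.1.le⟩ h1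
    rw [le_div_iff₀' hn0', lambertApprox] at h2
    linarith
  refine le_of_forall_lt_imp_le_of_dense fun b hb => le_liminf_of_le hcob ?_
  have hb' : γ < S * Real.exp (-b) := by
    rw [Real.lt_log_iff_exp_lt (div_pos hS hγ0), lt_div_iff₀ hγ0] at hb
    rw [Real.exp_neg, ← div_eq_mul_inv, lt_div_iff₀ (Real.exp_pos b)]
    linarith
  filter_upwards [hmem, eventually_Phi_lt hS hb', eventually_lambertApprox_div_mem b,
    eventually_gt_atTop 0] with n h1 h2 h3 hn0
  have hn0' : (0 : ℝ) < n := by exact_mod_cast hn0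
  have h4 : lambertApprox b n / n ≤ epsStar S α n := by
    refine le_csInf ⟨_, h1⟩ fun ε hε => ?_
    by_contra! hlt
    have := Phi_mono hS n hε.1 ⟨h3.1, by linarith [h3.2]⟩ hlt.le
    linarith [hε.2]
  rw [div_le_iff₀' hn0', lambertApprox] at h4
  linarith
end
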